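/- Let A ⊆ ℝ^m and B ⊆ ℝ^n be closed cones with 0 ∈ A and 0 ∈ B, and let Ṽ ⊆ ℝ^{m+n} be a closed cone such that (A × B) ∩ Ṽ contains no point of the form (ξ, 0) with ξ ≠ 0. Let r, r₂, r' ∈ ℝ satisfy r ≤ r₂ + min{0, r'}. Then there exists c' > 0 such that for all measurable functions F : ℝ^m → ℂ and G : ℝ^n → ℂ one has (∫∫_{(A×B)∩Ṽ} ⟨(ξ,η)⟩^{2r} |F(ξ)|² |G(η)|² dξ dη)^{1/2} ≤ c' · ‖⟨·⟩^{r'} F‖_{L²(ℝ^m)} · ‖⟨·⟩^{r₂} G‖_{L²(B)}, with both sides interpreted in [0,∞]. -/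

import Mathlib

open scoped ENNReal
open MeasureTheory

/-- A cone in a real vector space: closed under multiplication by positive scalars. -/
def IsConeSet {E : Type*} [SMul ℝ E] (V : Set E) : Prop :=
  ∀ ⦃x⦄, x ∈ V → ∀ ⦃lam : ℝ⦄, 0 < lam → lam • x ∈ V

/-- The Japanese bracket `⟨x⟩ = (1 + |x|²)^(1/2)`. -/
noncomputable def jb {E : Type*} [NormedAddCommGroup E] (x : E) : ℝ :=
  Real.sqrt (1 + ‖x‖ ^ 2)

/-- Concatenation of `ξ ∈ ℝ^m` and `η ∈ ℝ^n` into `(ξ, η) ∈ ℝ^(m+n)`. -/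
noncomputable def concatE {m n : ℕ} (ξ : EuclideanSpace ℝ (Fin m))
    (η : EuclideanSpace ℝ (Fin n)) : EuclideanSpace ℝ (Fin (m + n)) :=
  (EuclideanSpace.equiv (Fin (m + n)) ℝ).symm
    (Fin.append (fun i => ξ i) (fun j => η j))

theorem one_le_jb {E : Type*} [NormedAddCommGroup E] (x : E) : 1 ≤ jb x := by
  rw [jb, Real.one_le_sqrt]
  nlinarith [sq_nonneg ‖x‖]

theorem continuous_jb {E : Type*} [NormedAddCommGroup E] : Continuous (jb : E → ℝ) := by
  unfold jb
  fun_prop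

theorem continuous_jb_rpow {E : Type*} [NormedAddCommGroup E] (s : ℝ) :
    Continuous fun x : E => jb x ^ s :=
  continuous_jb.rpow_const fun x => Or.inl (zero_lt_one.trans_le (one_le_jb x)).ne'

section concatE

variable {m n : ℕ}

theorem norm_concatE_sq (ξ : EuclideanSpace ℝ (Fin m)) (η : EuclideanSpace ℝ (Fin n)) :
    ‖concatE ξ η‖ ^ 2 = ‖ξ‖ ^ 2 + ‖η‖ ^ 2 := by
  simp [EuclideanSpace.norm_sq_eq, concatE, Fin.sum_univ_add]

theorem smul_concatE (a : ℝ) (ξ : EuclideanSpace ℝ (Fin m)) (η : EuclideanSpace ℝ (Fin n)) :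
    a • concatE ξ η = concatE (a • ξ) (a • η) := by
  ext i
  refine Fin.addCases (fun i => ?_) (fun i => ?_) i <;> simp [concatE]

theorem continuous_concatE :
    Continuous fun p : EuclideanSpace ℝ (Fin m) × EuclideanSpace ℝ (Fin n) =>
      concatE p.1 p.2 := by
  refine (EuclideanSpace.equiv (Fin (m + n)) ℝ).symm.continuous.comp (continuous_pi fun i => ?_)
  refine Fin.addCases (fun i => ?_) (fun i => ?_) i
  · simp only [Fin.append_left]
    fun_prop
  · simp only [Fin.append_right]
    fun_prop

/-- If a closed cone contains no `(ξ, 0)` with `0 ≠ ξ ∈ A`, then `‖ξ‖` is controlled by `‖η‖`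
on the part of the cone lying over `A`. -/
theorem exists_norm_le_of_concatE_mem {A : Set (EuclideanSpace ℝ (Fin m))}
    {V : Set (EuclideanSpace ℝ (Fin (m + n)))} (hA : IsClosed A) (hAcone : IsConeSet A)
    (hV : IsClosed V) (hVcone : IsConeSet V)
    (hno : ∀ ξ : EuclideanSpace ℝ (Fin m), ξ ≠ 0 → ξ ∈ A →
      concatE ξ (0 : EuclideanSpace ℝ (Fin n)) ∉ V) :
    ∃ C : ℝ, 0 ≤ C ∧ ∀ ξ ∈ A, ∀ η : EuclideanSpace ℝ (Fin n), concatE ξ η ∈ V →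
      ‖ξ‖ ≤ C * ‖η‖ := by
  have hK : IsCompact (Metric.sphere (0 : EuclideanSpace ℝ (Fin m)) 1 ∩ A) :=
    (isCompact_sphere _ _).inter_right hA
  have hU : IsOpen {p : EuclideanSpace ℝ (Fin m) × EuclideanSpace ℝ (Fin n) |
      concatE p.1 p.2 ∈ Vᶜ} := hV.isOpen_compl.preimage continuous_concatE
  obtain ⟨u, v, -, hv, hKu, h0v, huv⟩ := generalized_tube_lemma hK
    (isCompact_singleton (x := (0 : EuclideanSpace ℝ (Fin n)))) hU (by
      rintro ⟨ξ, η⟩ ⟨⟨hξ, hξA⟩, hη⟩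
      obtain rfl : η = 0 := hη
      exact hno ξ (ne_zero_of_mem_unit_sphere ⟨ξ, hξ⟩) hξA)
  obtain ⟨ε, hε, hball⟩ := Metric.isOpen_iff.1 hv 0 (h0v rfl)
  refine ⟨ε⁻¹, by positivity, fun ξ hξ η hη => ?_⟩
  rcases eq_or_ne ξ 0 with rfl | hne
  · simp only [norm_zero]
    positivity
  have hpos : 0 < ‖ξ‖ := norm_pos_iff.2 hne
  by_contra! hlt
  have hu : ‖ξ‖⁻¹ • ξ ∈ u := hKu ⟨by simp [norm_smul, hpos.ne'], hAcone hξ (inv_pos.2 hpos)⟩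
  have hv' : ‖ξ‖⁻¹ • η ∈ v := hball (by
    rw [mem_ball_zero_iff, norm_smul, norm_inv, norm_norm, inv_mul_lt_iff₀ hpos]
    rwa [inv_mul_lt_iff₀ hε, mul_comm] at hlt)
  have hmem : concatE (‖ξ‖⁻¹ • ξ) (‖ξ‖⁻¹ • η) ∉ V := huv (Set.mk_mem_prod hu hv')
  exact hmem (smul_concatE _ ξ η ▸ hVcone hη (inv_pos.2 hpos))

theorem jb_le_jb_concatE_left (ξ : EuclideanSpace ℝ (Fin m)) (η : EuclideanSpace ℝ (Fin n)) :
    jb ξ ≤ jb (concatE ξ η) := by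
  refine Real.sqrt_le_sqrt ?_
  rw [norm_concatE_sq]
  nlinarith [sq_nonneg ‖η‖]

theorem jb_le_jb_concatE_right (ξ : EuclideanSpace ℝ (Fin m)) (η : EuclideanSpace ℝ (Fin n)) :
    jb η ≤ jb (concatE ξ η) := by
  refine Real.sqrt_le_sqrt ?_
  rw [norm_concatE_sq]
  nlinarith [sq_nonneg ‖ξ‖]

theorem jb_concatE_le {C : ℝ} (hC : 0 ≤ C) {ξ : EuclideanSpace ℝ (Fin m)}
    {η : EuclideanSpace ℝ (Fin n)} (h : ‖ξ‖ ≤ C * ‖η‖) :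
    jb (concatE ξ η) ≤ (1 + C) * jb η := by
  rw [jb, jb, Real.sqrt_le_left (by positivity), mul_pow, Real.sq_sqrt (by positivity),
    norm_concatE_sq]
  have : ‖ξ‖ ^ 2 ≤ (C * ‖η‖) ^ 2 := pow_le_pow_left₀ (norm_nonneg _) h 2
  nlinarith [sq_nonneg ‖η‖, mul_nonneg hC (sq_nonneg ‖η‖), sq_nonneg C]

end concatE

theorem Real.rpow_le_mul_rpow_of_comparable {K y z s : ℝ} (hK : 1 ≤ K) (hy : 0 < y)
    (hyz : y ≤ z) (hzy : z ≤ K * y) : z ^ s ≤ K ^ |s| * y ^ s := by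
  rcases le_total 0 s with hs | hs
  · rw [abs_of_nonneg hs, ← Real.mul_rpow (by positivity) hy.le]
    exact Real.rpow_le_rpow (hy.le.trans hyz) hzy hs
  · calc z ^ s ≤ y ^ s := Real.rpow_le_rpow_of_nonpos hy hyz hs
      _ ≤ K ^ |s| * y ^ s :=
        le_mul_of_one_le_left (by positivity) (Real.one_le_rpow hK (abs_nonneg s))

theorem Real.rpow_le_mul_rpow_mul_rpow {K x y z r s t : ℝ} (hK : 1 ≤ K) (hx : 1 ≤ x)
    (hy : 1 ≤ y) (hxz : x ≤ z) (hyz : y ≤ z) (hzy : z ≤ K * y) (hr : r ≤ s + min 0 t) :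
    z ^ (2 * r) ≤ K ^ |2 * s| * x ^ (2 * t) * y ^ (2 * s) := by
  have hx0 : 0 < x := by linarith
  have hy0 : 0 < y := by linarith
  have hz0 : 0 < z := by linarith
  calc z ^ (2 * r) ≤ z ^ (2 * s + 2 * min 0 t) :=
        Real.rpow_le_rpow_of_exponent_le (hx.trans hxz) (by linarith)
    _ = z ^ (2 * s) * z ^ (2 * min 0 t) := Real.rpow_add hz0 _ _
    _ ≤ (K ^ |2 * s| * y ^ (2 * s)) * x ^ (2 * t) := by
        gcongr
        · exact Real.rpow_le_mul_rpow_of_comparable hK hy0 hyz hzy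
        · calc z ^ (2 * min 0 t) ≤ x ^ (2 * min 0 t) :=
                Real.rpow_le_rpow_of_nonpos hx0 hxz (by linarith [min_le_left 0 t])
            _ ≤ x ^ (2 * t) :=
                Real.rpow_le_rpow_of_exponent_le hx (by linarith [min_le_right 0 t])
    _ = K ^ |2 * s| * x ^ (2 * t) * y ^ (2 * s) := by ring

theorem stmt_13 {m n : ℕ}
    (A : Set (EuclideanSpace ℝ (Fin m))) (B : Set (EuclideanSpace ℝ (Fin n)))
    (Vt : Set (EuclideanSpace ℝ (Fin (m + n))))
    (hAcl : IsClosed A) (hAcone : IsConeSet A) (hA0 : (0 : EuclideanSpace ℝ (Fin m)) ∈ A)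
    (hBcl : IsClosed B) (hBcone : IsConeSet B) (hB0 : (0 : EuclideanSpace ℝ (Fin n)) ∈ B)
    (hVtcl : IsClosed Vt) (hVtcone : IsConeSet Vt)
    (hno : ∀ ξ : EuclideanSpace ℝ (Fin m), ξ ≠ 0 → ξ ∈ A →
      concatE ξ (0 : EuclideanSpace ℝ (Fin n)) ∉ Vt)
    (r r₂ r' : ℝ) (hr : r ≤ r₂ + min 0 r') :
    ∃ c' : ℝ, 0 < c' ∧
      ∀ (F : EuclideanSpace ℝ (Fin m) → ℂ) (G : EuclideanSpace ℝ (Fin n) → ℂ),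
        Measurable F → Measurable G →
        (∫⁻ ξ in A, ∫⁻ η in {η : EuclideanSpace ℝ (Fin n) | η ∈ B ∧ concatE ξ η ∈ Vt},
            ENNReal.ofReal (jb (concatE ξ η) ^ (2 * r)) * (‖F ξ‖₊ : ℝ≥0∞) ^ 2
              * (‖G η‖₊ : ℝ≥0∞) ^ 2) ^ (1 / 2 : ℝ)
          ≤ ENNReal.ofReal c'
            * (∫⁻ ξ, ENNReal.ofReal (jb ξ ^ (2 * r')) * (‖F ξ‖₊ : ℝ≥0∞) ^ 2) ^ (1 / 2 : ℝ)
            * (∫⁻ η in B, ENNReal.ofReal (jb η ^ (2 * r₂)) * (‖G η‖₊ : ℝ≥0∞) ^ 2) ^ (1 / 2 : ℝ) := by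
  obtain ⟨C, hC, hbound⟩ := exists_norm_le_of_concatE_mem hAcl hAcone hVtcl hVtcone hno
  have hK : (1 : ℝ) ≤ 1 + C := by linarith
  set M : ℝ := (1 + C) ^ |2 * r₂| with hM
  have hMpos : 0 < M := by positivity
  refine ⟨M ^ (1 / 2 : ℝ), by positivity, fun F G hF hG => ?_⟩
  set f : EuclideanSpace ℝ (Fin m) → ℝ≥0∞ :=
    fun ξ => ENNReal.ofReal (jb ξ ^ (2 * r')) * (‖F ξ‖₊ : ℝ≥0∞) ^ 2 with hf
  set g : EuclideanSpace ℝ (Fin n) → ℝ≥0∞ :=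
    fun η => ENNReal.ofReal (jb η ^ (2 * r₂)) * (‖G η‖₊ : ℝ≥0∞) ^ 2 with hg
  have hfm : Measurable f :=
    (continuous_jb_rpow _).measurable.ennreal_ofReal.mul (hF.nnnorm.coe_nnreal_ennreal.pow_const 2)
  have hgm : Measurable g :=
    (continuous_jb_rpow _).measurable.ennreal_ofReal.mul (hG.nnnorm.coe_nnreal_ennreal.pow_const 2)
  rw [← ENNReal.ofReal_rpow_of_pos hMpos, ← ENNReal.mul_rpow_of_nonneg _ _ (by norm_num),
    ← ENNReal.mul_rpow_of_nonneg _ _ (by norm_num)]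
  refine ENNReal.rpow_le_rpow ?_ (by norm_num)
  calc _ ≤ ∫⁻ ξ in A, ENNReal.ofReal M * f ξ * ∫⁻ η in B, g η := by
        refine setLIntegral_mono' hAcl.measurableSet fun ξ hξ => ?_
        rw [← lintegral_const_mul _ hgm]
        have hS : IsClosed {η : EuclideanSpace ℝ (Fin n) | η ∈ B ∧ concatE ξ η ∈ Vt} :=
          hBcl.inter (hVtcl.preimage (continuous_concatE.comp (Continuous.prodMk_right ξ)))
        refine (setLIntegral_mono' hS.measurableSet fun η hη => ?_).trans
          (lintegral_mono_set fun η hη => hη.1)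
        have hw := Real.rpow_le_mul_rpow_mul_rpow hK (one_le_jb ξ) (one_le_jb η)
          (jb_le_jb_concatE_left ξ η) (jb_le_jb_concatE_right ξ η)
          (jb_concatE_le hC (hbound ξ hξ η hη.2)) hr
        have hjξ : 0 ≤ jb ξ := Real.sqrt_nonneg _
        calc _ ≤ ENNReal.ofReal (M * jb ξ ^ (2 * r') * jb η ^ (2 * r₂)) * (‖F ξ‖₊ : ℝ≥0∞) ^ 2
              * (‖G η‖₊ : ℝ≥0∞) ^ 2 := by gcongr
          _ = _ := by
            rw [ENNReal.ofReal_mul (by positivity), ENNReal.ofReal_mul hMpos.le]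
            simp only [hf, hg]
            ring
    _ ≤ ∫⁻ ξ, ENNReal.ofReal M * f ξ * ∫⁻ η in B, g η := setLIntegral_le_lintegral _ _
    _ = _ := by
        rw [lintegral_mul_const _ (hfm.const_mul _), lintegral_const_mul _ hfm]
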